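/- Let ρ > 0, μ > 0, A > 0 be real numbers, let λ ∈ ℂ with λ ∉ (−∞,0], let a ∈ ℝ, and let B be the principal square root of (ρ/μ)λ + A². Then the function ξ ↦ ξ e^{iaξ} / ((A² + ξ²)(ρλ + μ(A² + ξ²))) is integrable on ℝ and (1/(2π)) ∫_ℝ ξ e^{iaξ} / ((A² + ξ²)(ρλ + μ(A² + ξ²))) dξ = sign(a) · (i/(2ρλ)) ( e^{−|a|A} − e^{−|a|B} ), where sign(a) = 1 for a > 0, sign(a) = −1 for a < 0, and sign(0) = 0. -/

import Mathlib

open MeasureTheory Complex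

open scoped FourierTransform

/-- The odd continuous function on `ℝ` equal to `exp (-b t) - exp (-c t)` for `t > 0`. -/
noncomputable def oddExpDiff (b c : ℂ) (t : ℝ) : ℂ :=
  if t ≤ 0 then exp (c * t) - exp (b * t) else exp (-b * t) - exp (-c * t)

lemma continuous_oddExpDiff (b c : ℂ) : Continuous (oddExpDiff b c) := by
  refine Continuous.if_le (by fun_prop) (by fun_prop) continuous_id continuous_const ?_
  rintro x rfl
  simp

lemma oddExpDiff_eq_sign_mul (b c : ℂ) (t : ℝ) :
    oddExpDiff b c t =
      (Real.sign t : ℂ) * (exp (-((|t| : ℝ) : ℂ) * b) - exp (-((|t| : ℝ) : ℂ) * c)) := by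
  rcases lt_trichotomy t 0 with h | rfl | h
  · simp [oddExpDiff, h.le, Real.sign_of_neg h, abs_of_neg h, mul_comm]
  · simp [oddExpDiff]
  · simp [oddExpDiff, h.not_ge, Real.sign_of_pos h, abs_of_pos h, mul_comm]

lemma integrable_and_integral_exp_mul_oddExpDiff {b c : ℂ} (hb : 0 < b.re) (hc : 0 < c.re) (s : ℝ) :
    Integrable (fun t : ℝ => exp (-(I * s * t)) * oddExpDiff b c t) ∧
      ∫ t : ℝ, exp (-(I * s * t)) * oddExpDiff b c t =
        1 / (c - I * s) - 1 / (b - I * s) + (1 / (b + I * s) - 1 / (c + I * s)) := by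
  have hIic {z : ℂ} (hz : 0 < z.re) : 0 < (z - I * s).re := by simpa
  have hIoi {z : ℂ} (hz : 0 < z.re) : (-(z + I * s)).re < 0 := by simpa
  have eIic : Set.EqOn (fun t : ℝ => exp (-(I * s * t)) * oddExpDiff b c t)
      (fun t : ℝ => exp ((c - I * s) * t) - exp ((b - I * s) * t)) (Set.Iic 0) := by
    intro t ht
    simp only [oddExpDiff, if_pos (Set.mem_Iic.mp ht), mul_sub, ← exp_add]
    ring_nf
  have eIoi : Set.EqOn (fun t : ℝ => exp (-(I * s * t)) * oddExpDiff b c t)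
      (fun t : ℝ => exp (-(b + I * s) * t) - exp (-(c + I * s) * t)) (Set.Ioi 0) := by
    intro t ht
    simp only [oddExpDiff, if_neg (Set.mem_Ioi.mp ht).not_ge, mul_sub, ← exp_add]
    ring_nf
  have iIic {z : ℂ} (hz : 0 < z.re) := integrableOn_exp_mul_complex_Iic (hIic hz) 0
  have iIoi {z : ℂ} (hz : 0 < z.re) := integrableOn_exp_mul_complex_Ioi (hIoi hz) 0
  have jIic := ((iIic hc).sub (iIic hb)).congr_fun eIic.symm measurableSet_Iic
  have jIoi := ((iIoi hb).sub (iIoi hc)).congr_fun eIoi.symm measurableSet_Ioi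
  refine ⟨by simpa using jIic.union jIoi, ?_⟩
  rw [← intervalIntegral.integral_Iic_add_Ioi jIic jIoi,
    setIntegral_congr_fun measurableSet_Iic eIic, setIntegral_congr_fun measurableSet_Ioi eIoi,
    integral_sub (iIic hc) (iIic hb), integral_sub (iIoi hb) (iIoi hc),
    integral_exp_mul_complex_Iic (hIic hc), integral_exp_mul_complex_Iic (hIic hb),
    integral_exp_mul_complex_Ioi (hIoi hb), integral_exp_mul_complex_Ioi (hIoi hc)]
  simp only [ofReal_zero, mul_zero, exp_zero, neg_div_neg_eq]

lemma sq_add_sq_eq_mul (z : ℂ) (s : ℝ) : z ^ 2 + (s : ℂ) ^ 2 = (z + I * s) * (z - I * s) := by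
  linear_combination (s : ℂ) ^ 2 * I_sq

lemma re_mul_abs_le_norm_sq_add_sq {z : ℂ} (hz : 0 < z.re) (s : ℝ) :
    z.re * |s| ≤ ‖z ^ 2 + (s : ℂ) ^ 2‖ := by
  have h₁ : z.re ≤ ‖z + I * s‖ := by simpa using re_le_norm (z + I * s)
  have h₂ : z.re ≤ ‖z - I * s‖ := by simpa using re_le_norm (z - I * s)
  have h₃ : |z.im + s| ≤ ‖z + I * s‖ := by simpa using abs_im_le_norm (z + I * s)
  have h₄ : |z.im - s| ≤ ‖z - I * s‖ := by simpa using abs_im_le_norm (z - I * s)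
  have h₅ : |s| ≤ ‖z + I * s‖ ∨ |s| ≤ ‖z - I * s‖ := by
    rcases le_total 0 z.im with h | h <;> rcases le_total 0 s with h' | h'
    all_goals simp only [abs_of_nonneg, abs_of_nonpos, h'] at *
    · left; linarith [le_abs_self (z.im + s)]
    · right; linarith [le_abs_self (z.im - s)]
    · right; linarith [neg_abs_le (z.im - s)]
    · left; linarith [neg_abs_le (z.im + s)]
  rw [sq_add_sq_eq_mul, norm_mul]
  rcases h₅ with h | h
  · rw [mul_comm]
    exact mul_le_mul h h₂ hz.le (norm_nonneg _)
  · exact mul_le_mul h₁ h (abs_nonneg s) (norm_nonneg _)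

lemma sq_add_sq_ne_zero {z : ℂ} (hz : 0 < z.re) (s : ℝ) : z ^ 2 + (s : ℂ) ^ 2 ≠ 0 := by
  rw [sq_add_sq_eq_mul]
  refine mul_ne_zero (fun h => ?_) (fun h => ?_) <;>
  · have := congrArg re h
    simp at this
    exact hz.ne' this

lemma integrable_inv_sq_add_sq {A : ℝ} (hA : 0 < A) :
    Integrable (fun ξ : ℝ => (A ^ 2 + ξ ^ 2)⁻¹) := by
  refine ((integrable_inv_one_add_sq.comp_div hA.ne').const_mul (A ^ 2)⁻¹).congr (.of_forall ?_)
  intro ξ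
  field_simp

lemma integrable_mul_exp_div_sq_add_sq {A : ℝ} (hA : 0 < A) {B : ℂ} (hB : 0 < B.re) (a : ℝ) :
    Integrable (fun ξ : ℝ => (ξ : ℂ) * exp (I * a * ξ) /
      (((A : ℂ) ^ 2 + (ξ : ℂ) ^ 2) * (B ^ 2 + (ξ : ℂ) ^ 2))) := by
  have hA' : 0 < (A : ℂ).re := by simpa
  refine ((integrable_inv_sq_add_sq hA).const_mul B.re⁻¹).mono'
    (Continuous.aestronglyMeasurable ?_) (.of_forall fun ξ => ?_)
  · exact Continuous.div (by fun_prop) (by fun_prop)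
      fun ξ => mul_ne_zero (sq_add_sq_ne_zero hA' ξ) (sq_add_sq_ne_zero hB ξ)
  · have hexp : ‖exp (I * a * ξ)‖ = 1 := by simp [norm_exp]
    have hnA : ‖(A : ℂ) ^ 2 + (ξ : ℂ) ^ 2‖ = A ^ 2 + ξ ^ 2 := by
      rw [← ofReal_pow, ← ofReal_pow, ← ofReal_add, norm_real, Real.norm_of_nonneg (by positivity)]
    have hnB : 0 < ‖B ^ 2 + (ξ : ℂ) ^ 2‖ := norm_pos_iff.mpr (sq_add_sq_ne_zero hB ξ)
    rw [norm_div, norm_mul, norm_mul, hexp, hnA, mul_one, norm_real, Real.norm_eq_abs,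
      ← mul_inv, ← one_div, div_le_div_iff₀ (by positivity) (by positivity)]
    nlinarith [mul_le_mul_of_nonneg_left (re_mul_abs_le_norm_sq_add_sq hB ξ)
      (by positivity : 0 ≤ A ^ 2 + ξ ^ 2)]

lemma fourier_oddExpDiff {b c : ℂ} (hb : 0 < b.re) (hc : 0 < c.re) (w : ℝ) :
    𝓕 (oddExpDiff b c) w = -2 * I * (c ^ 2 - b ^ 2) * (((2 * Real.pi * w : ℝ) : ℂ) /
      ((b ^ 2 + ((2 * Real.pi * w : ℝ) : ℂ) ^ 2) * (c ^ 2 + ((2 * Real.pi * w : ℝ) : ℂ) ^ 2))) := by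
  have hint := (integrable_and_integral_exp_mul_oddExpDiff hb hc (2 * Real.pi * w)).2
  have e : 𝓕 (oddExpDiff b c) w =
      ∫ t : ℝ, exp (-(I * (2 * Real.pi * w : ℝ) * t)) * oddExpDiff b c t := by
    rw [Real.fourier_real_eq_integral_exp_smul]
    congr 1 with t
    rw [smul_eq_mul]
    push_cast
    ring_nf
  rw [e, hint]
  generalize 2 * Real.pi * w = s
  have nb := sq_add_sq_ne_zero hb s
  have nc := sq_add_sq_ne_zero hc s
  rw [sq_add_sq_eq_mul] at nb nc ⊢
  rw [sq_add_sq_eq_mul]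
  have := left_ne_zero_of_mul nb
  have := right_ne_zero_of_mul nb
  have := left_ne_zero_of_mul nc
  have := right_ne_zero_of_mul nc
  field_simp
  ring

lemma integral_mul_exp_div_sq_add_sq {A : ℝ} (hA : 0 < A) {B : ℂ} (hB : 0 < B.re) (a : ℝ) :
    -2 * I * (B ^ 2 - (A : ℂ) ^ 2) * (1 / (2 * (Real.pi : ℂ)) *
      ∫ ξ : ℝ, (ξ : ℂ) * exp (I * a * ξ) /
        (((A : ℂ) ^ 2 + (ξ : ℂ) ^ 2) * (B ^ 2 + (ξ : ℂ) ^ 2))) = oddExpDiff A B a := by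
  have hA' : 0 < (A : ℂ).re := by simpa
  have hF : 𝓕 (oddExpDiff A B) = _ := funext (fourier_oddExpDiff hA' hB)
  have hf : Integrable (oddExpDiff A B) := by
    simpa using (integrable_and_integral_exp_mul_oddExpDiff hA' hB 0).1
  have hFi : Integrable (𝓕 (oddExpDiff A B)) := by
    rw [hF]
    refine Integrable.const_mul ?_ _
    have := (integrable_mul_exp_div_sq_add_sq hA hB 0).comp_mul_left'
      (R := 2 * Real.pi) (by positivity)
    simpa using this
  have hinv := congrFun ((continuous_oddExpDiff A B).fourierInv_fourier_eq hf hFi) a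
  rw [← hinv, Real.fourierInv_eq', hF]
  have hcv := Measure.integral_comp_mul_left (fun ξ : ℝ => (ξ : ℂ) * exp (I * a * ξ) /
        (((A : ℂ) ^ 2 + (ξ : ℂ) ^ 2) * (B ^ 2 + (ξ : ℂ) ^ 2))) (2 * Real.pi)
  rw [abs_of_pos (by positivity), real_smul] at hcv
  have hpi : (((2 * Real.pi)⁻¹ : ℝ) : ℂ) = 1 / (2 * (Real.pi : ℂ)) := by push_cast; ring
  rw [← hpi, ← hcv, ← integral_const_mul]
  congr 1 with v
  have he : I * a * ((2 * Real.pi * v : ℝ) : ℂ) = ((2 * Real.pi * inner ℝ v a : ℝ) : ℂ) * I := by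
    simp
    ring
  rw [he, smul_eq_mul]
  ring

lemma cpow_half_re_pos {z : ℂ} (hz : z ∈ slitPlane) : 0 < (z ^ ((1 : ℂ) / 2)).re := by
  rw [cpow_def_of_ne_zero (slitPlane_ne_zero hz), exp_re]
  have him : (log z * (1 / 2)).im = z.arg / 2 := by
    rw [show (1 / 2 : ℂ) = ((1 / 2 : ℝ) : ℂ) by push_cast; rfl, im_mul_ofReal, log_im]
    ring
  have h₁ := neg_pi_lt_arg z
  have h₂ := lt_of_le_of_ne (arg_le_pi z) (mem_slitPlane_iff_arg.mp hz).1
  rw [him]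
  exact mul_pos (Real.exp_pos _) (Real.cos_pos_of_mem_Ioo ⟨by linarith, by linarith⟩)

/-- for real `ρ, μ, A > 0`, `λ ∈ ℂ ∖ (−∞,0]`, `a ∈ ℝ`, and `B` the principal
square root of `(ρ/μ)λ + A²`, the function
`ξ ↦ ξ e^{iaξ} / ((A² + ξ²)(ρλ + μ(A² + ξ²)))` is integrable on `ℝ` and
`(1/(2π)) ∫_ℝ ξ e^{iaξ}/((A²+ξ²)(ρλ+μ(A²+ξ²))) dξ
  = sign(a) (i/(2ρλ)) (e^{−|a|A} − e^{−|a|B})`. -/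
theorem statement7 (ρ μ A : ℝ) (hρ : 0 < ρ) (hμ : 0 < μ) (hA : 0 < A)
    (l : ℂ) (hl : ∀ x : ℝ, x ≤ 0 → l ≠ (x : ℂ)) (a : ℝ)
    (B : ℂ) (hB : B = (((ρ / μ : ℝ) : ℂ) * l + ((A : ℂ)) ^ 2) ^ ((1 : ℂ)/2)) :
    Integrable (fun ξ : ℝ =>
      (ξ : ℂ) * Complex.exp (Complex.I * (a : ℂ) * (ξ : ℂ)) /
        (((A : ℂ) ^ 2 + (ξ : ℂ) ^ 2) *
          ((ρ : ℂ) * l + (μ : ℂ) * ((A : ℂ) ^ 2 + (ξ : ℂ) ^ 2)))) ∧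
    (1 / (2 * (Real.pi : ℂ))) *
        ∫ ξ : ℝ, (ξ : ℂ) * Complex.exp (Complex.I * (a : ℂ) * (ξ : ℂ)) /
          (((A : ℂ) ^ 2 + (ξ : ℂ) ^ 2) *
            ((ρ : ℂ) * l + (μ : ℂ) * ((A : ℂ) ^ 2 + (ξ : ℂ) ^ 2)))
      = ((Real.sign a : ℝ) : ℂ) * (Complex.I / (2 * (ρ : ℂ) * l)) *
          (Complex.exp (-((|a| * A : ℝ) : ℂ)) - Complex.exp (-((|a| : ℝ) : ℂ) * B)) := by
  have hl_slit : l ∈ slitPlane := by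
    rw [mem_slitPlane_iff]
    by_contra! h
    exact hl l.re h.1 (Complex.ext (by simp) (by simpa using h.2))
  have hl0 : l ≠ 0 := slitPlane_ne_zero hl_slit
  have hρ0 : (ρ : ℂ) ≠ 0 := ofReal_ne_zero.mpr hρ.ne'
  have hμ0 : (μ : ℂ) ≠ 0 := ofReal_ne_zero.mpr hμ.ne'
  have hz : ((ρ / μ : ℝ) : ℂ) * l + (A : ℂ) ^ 2 ∈ slitPlane := by
    have hρμ : 0 < ρ / μ := div_pos hρ hμ
    have him : (((ρ / μ : ℝ) : ℂ) * l + (A : ℂ) ^ 2).im = ρ / μ * l.im := by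
      rw [← ofReal_pow, add_im, im_ofReal_mul, ofReal_im, add_zero]
    have hre : (((ρ / μ : ℝ) : ℂ) * l + (A : ℂ) ^ 2).re = ρ / μ * l.re + A ^ 2 := by
      rw [← ofReal_pow, add_re, re_ofReal_mul, ofReal_re]
    rw [mem_slitPlane_iff, him, hre]
    rcases mem_slitPlane_iff.mp hl_slit with h | h
    · left; positivity
    · right; exact mul_ne_zero hρμ.ne' h
  have hBre : 0 < B.re := hB ▸ cpow_half_re_pos hz
  have hBsq : B ^ 2 = (ρ : ℂ) / μ * l + (A : ℂ) ^ 2 := by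
    rw [hB, one_div, cpow_ofNat_inv_pow, ofReal_div]
  have hfun : (fun ξ : ℝ => (ξ : ℂ) * exp (I * (a : ℂ) * (ξ : ℂ)) /
      (((A : ℂ) ^ 2 + (ξ : ℂ) ^ 2) * ((ρ : ℂ) * l + (μ : ℂ) * ((A : ℂ) ^ 2 + (ξ : ℂ) ^ 2)))) =
      fun ξ : ℝ => (μ : ℂ)⁻¹ * ((ξ : ℂ) * exp (I * a * ξ) /
        (((A : ℂ) ^ 2 + (ξ : ℂ) ^ 2) * (B ^ 2 + (ξ : ℂ) ^ 2))) := by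
    ext ξ
    have hden : (ρ : ℂ) * l + (μ : ℂ) * ((A : ℂ) ^ 2 + (ξ : ℂ) ^ 2) =
        μ * (B ^ 2 + (ξ : ℂ) ^ 2) := by
      rw [hBsq]
      field_simp
      ring
    rw [hden, mul_left_comm ((A : ℂ) ^ 2 + (ξ : ℂ) ^ 2)]
    simp only [div_eq_mul_inv, mul_inv]
    ring
  have hint := integral_mul_exp_div_sq_add_sq hA hBre a
  rw [oddExpDiff_eq_sign_mul, hBsq] at hint
  rw [hfun]
  refine ⟨(integrable_mul_exp_div_sq_add_sq hA hBre a).const_mul _, ?_⟩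
  rw [integral_const_mul, hBsq]
  generalize (∫ ξ : ℝ, _ : ℂ) = J at hint ⊢
  rw [show -((|a| * A : ℝ) : ℂ) = -((|a| : ℝ) : ℂ) * (A : ℂ) by push_cast; ring,
    mul_right_comm, ← hint]
  field_simp
  linear_combination (J * ρ * l) * I_sq
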